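/- Let θ_g = (1+√5)/2, a > 0, and for j ∈ ℕ, j ≥ 1, set A_j := (2π/(√5·a))·(θ_g^{2j} − θ_g^{−2j})·tan((π/2)θ_g^{−2j}). Then the sequence (A_j)_{j≥1} is strictly increasing, A_1 = (2π/a)·tan((3−√5)π/4), A_j < π²/(√5·a) for every j ≥ 1, and A_j → π²/(√5·a) as j → ∞. -/

import Mathlib

open Real Filter

/-- The threshold coupling strengths `A_j` for the golden-mean rectangular lattice. -/
noncomputable def goldenThreshold (a : ℝ) (j : ℕ) : ℝ :=
  2 * π / (Real.sqrt 5 * a) *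
    (((1 + Real.sqrt 5) / 2) ^ (2 * (j : ℤ)) - ((1 + Real.sqrt 5) / 2) ^ (-(2 * (j : ℤ)))) *
    Real.tan (π / 2 * ((1 + Real.sqrt 5) / 2) ^ (-(2 * (j : ℤ))))

/-- The function interpolating the thresholds, in the variable `x = θ_g ^ (-2 * j)`. -/
noncomputable def thresholdProfile (x : ℝ) : ℝ := (x⁻¹ - x) * Real.tan (π / 2 * x)

lemma inv_sq_golden : (((1 + Real.sqrt 5) / 2) ^ 2)⁻¹ = (3 - Real.sqrt 5) / 2 := by
  have h5 : Real.sqrt 5 ^ 2 = 5 := Real.sq_sqrt (by norm_num)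
  refine inv_eq_of_mul_eq_one_right ?_
  linear_combination ((1 - Real.sqrt 5) / 8) * h5

lemma sqrt_five_bounds : 2.2 < Real.sqrt 5 ∧ Real.sqrt 5 < 2.3 :=
  ⟨Real.lt_sqrt_of_sq_lt (by norm_num), (Real.sqrt_lt' (by norm_num)).2 (by norm_num)⟩

lemma goldenThreshold_eq_profile (a : ℝ) (j : ℕ) :
    goldenThreshold a j =
      2 * π / (Real.sqrt 5 * a) * thresholdProfile (((3 - Real.sqrt 5) / 2) ^ j) := by
  have h : ((1 + Real.sqrt 5) / 2) ^ (2 * (j : ℤ)) = (((3 - Real.sqrt 5) / 2) ^ j)⁻¹ := by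
    rw [← inv_sq_golden, inv_pow, inv_inv, ← pow_mul]
    exact_mod_cast rfl
  rw [goldenThreshold, thresholdProfile, zpow_neg, h, inv_inv, mul_assoc]

lemma redheffer_of_le {x : ℝ} (hx : 0 < x) (hx' : x ≤ 0.4) :
    π * x * (1 - x ^ 2) < (1 + x ^ 2) * Real.sin (π * x) := by
  have hpi : π ^ 2 < 10 := by nlinarith [Real.pi_lt_d2, Real.pi_pos]
  have hx2 : x ^ 2 ≤ 0.16 := by nlinarith
  have hy : 0 < π * x := mul_pos Real.pi_pos hx
  have hsin := mul_lt_mul_of_pos_left (Real.sin_gt_sub_cube hy) (show 0 < 1 + x ^ 2 by positivity)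
  refine lt_of_le_of_lt ?_ hsin
  have key : 0 ≤ 2 - π ^ 2 / 6 * (1 + x ^ 2) := by nlinarith [sq_nonneg x]
  have := mul_nonneg (mul_nonneg hy.le (sq_nonneg x)) key
  linarith

lemma hasDerivAt_thresholdProfile {x : ℝ} (hx : x ≠ 0) (hc : Real.cos (π / 2 * x) ≠ 0) :
    HasDerivAt thresholdProfile
      ((-(x ^ 2)⁻¹ - 1) * Real.tan (π / 2 * x) +
        (x⁻¹ - x) * (1 / Real.cos (π / 2 * x) ^ 2 * (π / 2))) x := by
  have hlin : HasDerivAt (fun y : ℝ => π / 2 * y) (π / 2) x := by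
    simpa using (hasDerivAt_id x).const_mul (π / 2)
  exact ((hasDerivAt_inv hx).sub (hasDerivAt_id x)).mul ((Real.hasDerivAt_tan hc).comp x hlin)

lemma cos_half_pi_mul_pos {x : ℝ} (hx : 0 < x) (hx' : x ≤ 0.4) : 0 < Real.cos (π / 2 * x) :=
  Real.cos_pos_of_mem_Ioo ⟨by nlinarith [Real.pi_pos], by nlinarith [Real.pi_pos]⟩

lemma thresholdProfile_strictAntiOn : StrictAntiOn thresholdProfile (Set.Ioc 0 0.4) := by
  refine strictAntiOn_of_deriv_neg (convex_Ioc ..) (fun x hx => ?_) (fun x hx => ?_)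
  · exact (hasDerivAt_thresholdProfile hx.1.ne'
      (cos_half_pi_mul_pos hx.1 hx.2).ne').continuousAt.continuousWithinAt
  · rw [interior_Ioc] at hx
    have hx0 := hx.1
    have hc := cos_half_pi_mul_pos hx.1 hx.2.le
    rw [(hasDerivAt_thresholdProfile hx0.ne' hc.ne').deriv]
    have h := redheffer_of_le hx.1 hx.2.le
    rw [show π * x = 2 * (π / 2 * x) by ring, Real.sin_two_mul] at h
    rw [Real.tan_eq_sin_div_cos]
    have e : (-(x ^ 2)⁻¹ - 1) * (Real.sin (π / 2 * x) / Real.cos (π / 2 * x)) +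
        (x⁻¹ - x) * (1 / Real.cos (π / 2 * x) ^ 2 * (π / 2)) =
        (2 * (π / 2 * x) * (1 - x ^ 2) -
          (1 + x ^ 2) * (2 * Real.sin (π / 2 * x) * Real.cos (π / 2 * x))) /
          (2 * x ^ 2 * Real.cos (π / 2 * x) ^ 2) := by
      field_simp
      ring
    rw [e]
    exact div_neg_of_neg_of_pos (sub_neg.2 h) (by positivity)

lemma tendsto_thresholdProfile :
    Tendsto thresholdProfile (nhdsWithin 0 {0}ᶜ) (nhds (π / 2)) := by
  have hlin : HasDerivAt (fun y : ℝ => π / 2 * y) (π / 2) 0 := by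
    simpa using (hasDerivAt_id (0 : ℝ)).const_mul (π / 2)
  have htan : HasDerivAt (fun y : ℝ => Real.tan (π / 2 * y)) (π / 2) 0 := by
    have := (Real.hasDerivAt_tan (x := π / 2 * 0) (by simp)).comp 0 hlin
    simpa [Function.comp_def] using this
  have hslope := htan.tendsto_slope_zero
  have hpoly : Tendsto (fun x : ℝ => 1 - x ^ 2) (nhdsWithin 0 {0}ᶜ) (nhds 1) := by
    have : ContinuousAt (fun x : ℝ => 1 - x ^ 2) 0 := by fun_prop
    simpa using this.tendsto.mono_left nhdsWithin_le_nhds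
  have hmul := hpoly.mul hslope
  rw [one_mul] at hmul
  refine hmul.congr' ?_
  filter_upwards [self_mem_nhdsWithin] with x hx
  have hx0 : x ≠ 0 := hx
  simp only [zero_add, mul_zero, Real.tan_zero, sub_zero, smul_eq_mul, thresholdProfile]
  field_simp

/-- The sequence of golden-mean threshold couplings `A_j`, `j ≥ 1`, is
strictly increasing, starts at `A_1 = (2π/a)·tan((3−√5)π/4)`, stays below `π²/(√5 a)`,
and converges to `π²/(√5 a)`. -/
theorem golden_threshold_properties (a : ℝ) (ha : 0 < a) :
    StrictMonoOn (goldenThreshold a) {j : ℕ | 1 ≤ j} ∧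
    goldenThreshold a 1 = 2 * π / a * Real.tan ((3 - Real.sqrt 5) * π / 4) ∧
    (∀ j : ℕ, 1 ≤ j → goldenThreshold a j < π ^ 2 / (Real.sqrt 5 * a)) ∧
    Tendsto (goldenThreshold a) atTop (nhds (π ^ 2 / (Real.sqrt 5 * a))) := by
  obtain ⟨hs1, hs2⟩ := sqrt_five_bounds
  set q : ℝ := (3 - Real.sqrt 5) / 2 with hq
  have hq0 : 0 < q := by rw [hq]; linarith
  have hq1 : q ≤ 0.4 := by rw [hq]; linarith
  have hC : 0 < 2 * π / (Real.sqrt 5 * a) := by positivity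
  have hmem : ∀ j : ℕ, 1 ≤ j → q ^ j ∈ Set.Ioc (0 : ℝ) 0.4 := fun j hj =>
    ⟨pow_pos hq0 j, (pow_le_of_le_one hq0.le (by linarith) (by omega)).trans hq1⟩
  have hmono : StrictMonoOn (goldenThreshold a) {j : ℕ | 1 ≤ j} := by
    intro i hi j hj hij
    rw [goldenThreshold_eq_profile, goldenThreshold_eq_profile]
    exact mul_lt_mul_of_pos_left (thresholdProfile_strictAntiOn (hmem j hj) (hmem i hi)
      (pow_lt_pow_right_of_lt_one₀ hq0 (by linarith) hij)) hC
  have hlim : Tendsto (goldenThreshold a) atTop (nhds (π ^ 2 / (Real.sqrt 5 * a))) := by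
    have hpow : Tendsto (fun j : ℕ => q ^ j) atTop (nhdsWithin 0 {0}ᶜ) :=
      tendsto_nhdsWithin_iff.2 ⟨tendsto_pow_atTop_nhds_zero_of_lt_one hq0.le (by linarith),
        Eventually.of_forall fun j => (pow_pos hq0 j).ne'⟩
    have h := (tendsto_thresholdProfile.comp hpow).const_mul (2 * π / (Real.sqrt 5 * a))
    rw [show 2 * π / (Real.sqrt 5 * a) * (π / 2) = π ^ 2 / (Real.sqrt 5 * a) by ring] at h
    exact h.congr fun j => (goldenThreshold_eq_profile a j).symm
  refine ⟨hmono, ?_, fun j hj => ?_, hlim⟩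
  · have hinv : q⁻¹ - q = Real.sqrt 5 := by
      have h5 : Real.sqrt 5 ^ 2 = 5 := Real.sq_sqrt (by norm_num)
      rw [hq, ← inv_sq_golden, inv_inv, inv_sq_golden]
      linear_combination h5 / 4
    rw [goldenThreshold_eq_profile, pow_one, thresholdProfile, hinv,
      show π / 2 * q = (3 - Real.sqrt 5) * π / 4 by rw [hq]; ring]
    field_simp
  · refine (hmono hj (Nat.le_succ_of_le hj) j.lt_succ_self).trans_le
      (ge_of_tendsto hlim ?_)
    filter_upwards [eventually_ge_atTop (j + 1)] with k hk
    exact hmono.monotoneOn (Nat.le_succ_of_le hj) (show 1 ≤ k by omega) hk
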